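/- Let n ≥ 1 and let κ be an infinite cardinal. Suppose A is an index set with |A| ≤ κ and for each α ∈ A, H_α is an algebraic hypergraph on ℝⁿ (the zero hypergraph of some (k_α,n)-ary polynomial, with possibly different uniformities k_α ≥ 2) such that χ(H_α) ≤ κ. Then there is a single function φ from ℝⁿ to a set of cardinality at most κ that is simultaneously a proper coloring of every H_α, α ∈ A. -/

import Mathlib

open Cardinal

/-- A hypergraph with vertex type `V` is identified with its set of edges
`E : Set (Set V)`.  It is `κ`-colorable if there is a function from `V` to a
set of cardinality at most `κ` that is not constant on any edge. -/
def HGColorable {V : Type} (E : Set (Set V)) (κ : Cardinal) : Prop :=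
  ∃ (α : Type) (φ : V → α), #α ≤ κ ∧ ∀ e ∈ E, ∃ x ∈ e, ∃ y ∈ e, φ x ≠ φ y

/-- The chromatic number of a hypergraph: the least cardinal `κ` such that it
has a proper `κ`-coloring. -/
noncomputable def chrNum {V : Type} (E : Set (Set V)) : Cardinal :=
  sInf {κ | HGColorable E κ}

/-- `cardSucc κ m = κ^{+m}`, the `m`-fold cardinal successor of `κ`. -/
noncomputable def cardSucc (κ : Cardinal) (m : ℕ) : Cardinal := (Order.succ)^[m] κ

/-- `Q` is a homomorphic image of the set `P` of `d`-tuples: there is a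
surjection `f : P → Q` such that `x i = y i` implies `f x i = f y i`. -/
def IsHomImage {d : ℕ} {A : Type} {B : Fin d → Type} (P : Set (Fin d → A))
    (Q : Set (∀ i, B i)) : Prop :=
  ∃ f : (Fin d → A) → (∀ i, B i),
    Set.MapsTo f P Q ∧ Set.SurjOn f P Q ∧
    ∀ x ∈ P, ∀ y ∈ P, ∀ i, x i = y i → f x i = f y i

/-- The edges of the template hypergraph `L(X, P)` where `X = Π i, B i`:
the `k`-element subsets of the vertex set that are homomorphic images of `P`. -/
def templateEdges (k : ℕ) {d : ℕ} {A : Type} {B : Fin d → Type}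
    (P : Set (Fin d → A)) : Set (Set (∀ i, B i)) :=
  {Q | Q.ncard = k ∧ IsHomImage P Q}

/-- `I` is a distinguisher for `P`: any two distinct members of `P` differ at
some coordinate in `I`. -/
def IsDistinguisher {d : ℕ} {A : Type} (P : Set (Fin d → A)) (I : Finset (Fin d)) : Prop :=
  ∀ x ∈ P, ∀ y ∈ P, x ≠ y → ∃ i ∈ I, x i ≠ y i

/-- `eDim P = e(P)`, the least cardinality of a distinguisher for `P`. -/
noncomputable def eDim {d : ℕ} {A : Type} (P : Set (Fin d → A)) : ℕ :=
  sInf {e | ∃ I : Finset (Fin d), IsDistinguisher P I ∧ I.card = e}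

/-- A `d`-dimensional template is simple if for every `m < d` there are
`x, y ∈ P` with `x i = y i` exactly when `i ≠ m`. -/
def IsSimple {d : ℕ} {A : Type} (P : Set (Fin d → A)) : Prop :=
  ∀ m : Fin d, ∃ x ∈ P, ∃ y ∈ P, ∀ i, (x i = y i ↔ i ≠ m)

/-- The edges of the zero hypergraph of a `(k, n)`-ary real polynomial:
`k`-element subsets `{a_0, …, a_{k-1}}` of `ℝⁿ` with `p(a_0, …, a_{k-1}) = 0`
for some ordering of the elements. -/
def zeroEdges {n k : ℕ} (p : MvPolynomial (Fin k × Fin n) ℝ) :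
    Set (Set (Fin n → ℝ)) :=
  {A | ∃ a : Fin k → (Fin n → ℝ), Function.Injective a ∧ A = Set.range a ∧
        MvPolynomial.eval (fun q => a q.1 q.2) p = 0}

/-- `H₂ = (V₂, E₂)` contains (a copy of) `H₁ = (V₁, E₁)`: some injection
`V₁ → V₂` maps every edge of `H₁` onto an edge of `H₂`. -/
def HGContains {V₁ V₂ : Type} (E₁ : Set (Set V₁)) (E₂ : Set (Set V₂)) : Prop :=
  ∃ f : V₁ → V₂, Function.Injective f ∧ ∀ e ∈ E₁, f '' e ∈ E₂

theorem HGColorable.of_chrNum_le {V : Type} {E : Set (Set V)} {κ : Cardinal}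
    (hE : ∀ e ∈ E, ∃ x ∈ e, ∃ y ∈ e, x ≠ y) (h : chrNum E ≤ κ) : HGColorable E κ := by
  have hne : {κ | HGColorable E κ}.Nonempty := ⟨#V, V, id, le_rfl, hE⟩
  obtain ⟨C, φ, hC, hφ⟩ := csInf_mem hne
  exact ⟨C, φ, hC.trans h, hφ⟩

theorem le_cardSucc (κ : Cardinal) (m : ℕ) : κ ≤ cardSucc κ m :=
  Order.le_succ_iterate m κ

theorem cardSucc_succ (κ : Cardinal) (m : ℕ) :
    cardSucc κ (m + 1) = Order.succ (cardSucc κ m) :=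
  Function.iterate_succ_apply' _ _ _

theorem cardSucc_mono (κ : Cardinal) : Monotone (cardSucc κ) :=
  monotone_nat_of_le_succ fun m => by
    rw [cardSucc_succ]
    exact Order.le_succ _

theorem mk_pi_le_of_finite {ι T : Type} [Finite ι] {μ : Cardinal} (hμ : ℵ₀ ≤ μ) (hT : #T ≤ μ) :
    #(ι → T) ≤ μ := by
  obtain ⟨m, hm⟩ := Cardinal.lt_aleph0.1 (Cardinal.lt_aleph0_of_finite ι)
  rw [← Cardinal.power_def, hm]
  exact (Cardinal.power_le_power_right hT).trans (Cardinal.power_nat_le hμ)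

/-- If `#T ≤ κ^{+m}`, the set `T ^ r` can be colored with `κ` colors so that every color class
has a distinguisher of size at most `m`. -/
theorem exists_coloring_distinguisher {κ : Cardinal} (hκ : ℵ₀ ≤ κ) (m : ℕ) :
    ∀ T : Type, #T ≤ cardSucc κ m → ∀ r : ℕ,
      ∃ (ψ : (Fin r → T) → κ.out) (D : κ.out → Finset (Fin r)),
        (∀ c, (D c).card ≤ m) ∧ ∀ c, IsDistinguisher {t | ψ t = c} (D c) := by
  have hκo : ℵ₀ ≤ #κ.out := by rwa [mk_out]
  induction m with
  | zero =>
    intro T hT r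
    obtain ⟨ψ⟩ := Cardinal.le_def (Fin r → T) κ.out |>.1 <| by
      rw [mk_out]
      exact mk_pi_le_of_finite hκ hT
    refine ⟨ψ, fun _ => ∅, fun _ => by simp, fun c x hx y hy hxy => ?_⟩
    exact absurd (ψ.injective (hx.trans hy.symm)) hxy
  | succ m ih =>
    intro T hT r
    rcases Nat.eq_zero_or_pos r with rfl | hr
    · have : Nonempty κ.out := by
        rw [← Cardinal.mk_ne_zero_iff]
        exact (Cardinal.aleph0_pos.trans_le hκo).ne'
      exact ⟨fun _ => Classical.arbitrary _, fun _ => ∅, fun _ => by simp,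
        fun c x _ y _ hxy => absurd (Subsingleton.elim x y) hxy⟩
    obtain ⟨_, _, hlt⟩ := Cardinal.exists_ord_eq_type_lt T
    have hinit : ∀ τ : T, #(Set.Iic τ) ≤ cardSucc κ m := by
      intro τ
      have h1 : #(Set.Iio τ) ≤ cardSucc κ m := by
        rw [← Order.lt_succ_iff, ← cardSucc_succ]
        exact (Cardinal.mk_Iio_lt τ hlt).trans_le hT
      rw [← Set.Iio_insert]
      calc #(insert τ (Set.Iio τ) : Set T) ≤ #(Set.Iio τ) + 1 := Cardinal.mk_insert_le
        _ ≤ cardSucc κ m + 1 := by gcongr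
        _ = cardSucc κ m := Cardinal.add_one_eq (hκ.trans (le_cardSucc κ m))
    choose ψ D hD hψ using fun τ => ih _ (hinit τ) r
    have hmax : ∀ t : Fin r → T, ∃ i, ∀ j, t j ≤ t i := by
      intro t
      have : Nonempty (Fin r) := ⟨⟨0, hr⟩⟩
      exact Finite.exists_max t
    choose i hi using hmax
    let lower : ∀ (t : Fin r → T) (τ : T), (∀ j, t j ≤ τ) → Fin r → Set.Iic τ :=
      fun t τ h j => ⟨t j, h j⟩
    let col : (Fin r → T) → Fin r × κ.out × Finset (Fin r) := fun t =>
      (i t, ψ _ (lower t _ (hi t)), D (t (i t)) (ψ _ (lower t _ (hi t))))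
    obtain ⟨f⟩ := Cardinal.le_def (Fin r × κ.out × Finset (Fin r)) κ.out |>.1 <| by
      have hfin : ∀ X : Type, Finite X → #X ≤ #κ.out := fun X _ =>
        (Cardinal.lt_aleph0_of_finite X).le.trans hκo
      simp only [Cardinal.mk_prod, Cardinal.lift_id]
      exact Cardinal.mul_le_of_le hκo (hfin _ inferInstance)
        (Cardinal.mul_le_of_le hκo le_rfl (hfin _ inferInstance))
    have hdist : ∀ t t', col t = col t' → t ≠ t' →
        ∃ j ∈ insert (col t).1 (col t).2.2, t j ≠ t' j := by
      intro t t' h hne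
      by_cases hτ : t (i t) = t' (i t)
      · have key : ∀ τ (h₁ : ∀ j, t j ≤ τ) (h₂ : ∀ j, t' j ≤ τ),
            ψ τ (lower t τ h₁) = ψ τ (lower t' τ h₂) →
            ∃ j ∈ D τ (ψ τ (lower t τ h₁)), t j ≠ t' j := by
          intro τ h₁ h₂ h'
          obtain ⟨j, hj, hj'⟩ := hψ τ _ (lower t τ h₁) rfl (lower t' τ h₂) h'.symm
            fun h => hne (funext fun j => congrArg Subtype.val (congrFun h j))
          exact ⟨j, hj, fun h => hj' (Subtype.ext h)⟩
        simp only [col, Prod.mk.injEq] at h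
        have hτ' : t' (i t') = t (i t) := by rw [← h.1, hτ]
        have h₂ : ∀ j, t' j ≤ t (i t) := hτ' ▸ hi t'
        have hlower : ∀ τ (_ : t' (i t') = τ) (h₂ : ∀ j, t' j ≤ τ),
            ψ _ (lower t' _ (hi t')) = ψ τ (lower t' τ h₂) := by
          rintro _ rfl _
          rfl
        obtain ⟨j, hj, hj'⟩ := key _ (hi t) h₂ (h.2.1.trans (hlower _ hτ' h₂))
        exact ⟨j, Finset.mem_insert_of_mem hj, hj'⟩
      · exact ⟨i t, Finset.mem_insert_self _ _, hτ⟩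
    classical
    refine ⟨fun t => f (col t), fun c => if h : ∃ t, f (col t) = c then
      insert (col h.choose).1 (col h.choose).2.2 else ∅, fun c => ?_, fun c x hx y hy hne => ?_⟩
    · dsimp only
      split_ifs with h
      · exact (Finset.card_insert_le _ _).trans (Nat.succ_le_succ (hD _ _))
      · simp
    · have h : ∃ t, f (col t) = c := ⟨x, hx⟩
      have hx' : col h.choose = col x := f.injective (h.choose_spec.trans hx.symm)
      simp only [dif_pos h, hx']
      exact hdist x y (f.injective (hx.trans hy.symm)) hne

/-- The polarized partition property of `κ^{+e}`: a coloring of the `e`-th power with `κ` colors is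
constant on a product of sets of any prescribed finite size. -/
theorem exists_monochromatic_box {κ : Cardinal} (hκ : ℵ₀ ≤ κ) {C : Type} (hC : #C ≤ κ)
    (M : Type) [Finite M] (e : ℕ) :
    ∀ W : Type, cardSucc κ e ≤ #W → ∀ c : (Fin e → W) → C,
      ∃ y : Fin e → M → W, (∀ i, Function.Injective (y i)) ∧
        ∃ a, ∀ v : Fin e → M, c (fun i => y i (v i)) = a := by
  induction e with
  | zero =>
    intro W _ c
    exact ⟨fun i => i.elim0, fun i => i.elim0, c Fin.elim0,
      fun v => congrArg c (Subsingleton.elim _ _)⟩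
  | succ e ih =>
    intro W hW c
    have hinf : ℵ₀ ≤ cardSucc κ e := hκ.trans (le_cardSucc κ e)
    rw [cardSucc_succ, Order.succ_le_iff] at hW
    obtain ⟨j⟩ := Cardinal.le_def (cardSucc κ e).out W |>.1 (by rw [mk_out]; exact hW.le)
    choose y hy a ha using fun w => ih (cardSucc κ e).out (by rw [mk_out])
      (fun v => c (Fin.cons w fun i => j (v i)))
    have hlt : #((Fin e → M → (cardSucc κ e).out) × C) < #W := by
      refine lt_of_le_of_lt ?_ hW
      simp only [Cardinal.mk_prod, Cardinal.lift_id]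
      exact Cardinal.mul_le_of_le hinf (mk_pi_le_of_finite hinf (mk_pi_le_of_finite hinf
        (mk_out _).le)) (hC.trans (le_cardSucc κ e))
    have : Infinite W := Cardinal.infinite_iff.2 (hinf.trans hW.le)
    obtain ⟨⟨y₀, a₀⟩, hfib⟩ := Cardinal.exists_infinite_fiber (fun w => (y w, a w)) hlt
    obtain ⟨z⟩ := Cardinal.le_def M ((fun w => (y w, a w)) ⁻¹' {(y₀, a₀)} : Set W) |>.1
      ((Cardinal.lt_aleph0_of_finite M).le.trans (Cardinal.infinite_iff.1 hfib))
    have hz : ∀ m, y (z m) = y₀ ∧ a (z m) = a₀ := fun m => Prod.mk.injEq _ _ _ _ ▸ (z m).2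
    refine ⟨Fin.cons (fun m => (z m : W)) fun i m => j (y₀ i m), ?_, a₀, ?_⟩
    · refine Fin.cases ?_ fun i => ?_
      · exact Subtype.val_injective.comp z.injective
      · intro m m' h
        have := hy (z m) i
        rw [(hz m).1] at this
        exact this (j.injective h)
    · intro v
      have h := ha (z (v 0)) (fun i => v i.succ)
      rw [(hz (v 0)).1, (hz (v 0)).2] at h
      refine Eq.trans (congrArg c ?_) h
      ext i
      refine Fin.cases ?_ (fun i => ?_) i <;> simp

/-- If `κ ≤ μ` and `#T ≤ μ`, the set `T ^ r` can be colored with `κ` colors so that every color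
class has a distinguisher whose size `e` satisfies `κ^{+e} ≤ μ`. -/
theorem exists_coloring_cardSucc_le {κ μ : Cardinal} (hκ : ℵ₀ ≤ κ) (hκμ : κ ≤ μ) {T : Type}
    (hT : #T ≤ μ) (r : ℕ) :
    ∃ (ψ : (Fin r → T) → κ.out) (D : κ.out → Finset (Fin r)),
      (∀ c, cardSucc κ (D c).card ≤ μ) ∧ ∀ c, IsDistinguisher {t | ψ t = c} (D c) := by
  classical
  by_cases h : ∃ m, μ ≤ cardSucc κ m
  · have hmin : cardSucc κ (Nat.find h) ≤ μ := by
      rcases hm : Nat.find h with _ | m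
      · exact hκμ
      · rw [cardSucc_succ, Order.succ_le_iff]
        exact not_le.1 (Nat.find_min h (hm ▸ m.lt_succ_self))
    obtain ⟨ψ, D, hD, hψ⟩ :=
      exists_coloring_distinguisher hκ _ T (hT.trans (Nat.find_spec h)) r
    exact ⟨ψ, D, fun c => (cardSucc_mono κ (hD c)).trans hmin, hψ⟩
  · push Not at h
    have : Nonempty κ.out := by
      rw [← Cardinal.mk_ne_zero_iff, Cardinal.mk_out]
      exact (Cardinal.aleph0_pos.trans_le hκ).ne'
    refine ⟨fun _ => Classical.arbitrary _, fun _ => Finset.univ, fun c => (h _).le,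
      fun c x _ y _ hxy => ?_⟩
    obtain ⟨i, hi⟩ := Function.ne_iff.1 hxy
    exact ⟨i, Finset.mem_univ i, hi⟩

/-- The functions on `U` which extend to functions analytic on a neighborhood of `U`. -/
def analyticFunctions {ι : Type} [Fintype ι] (U : Set (ι → ℝ)) : Subalgebra ℝ (U → ℝ) where
  carrier := {f | ∃ g : (ι → ℝ) → ℝ, AnalyticOnNhd ℝ g U ∧ ∀ u : U, f u = g u}
  mul_mem' := by
    rintro _ _ ⟨g, hg, h⟩ ⟨g', hg', h'⟩
    exact ⟨g * g', hg.mul hg', fun u => by simp [h, h']⟩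
  add_mem' := by
    rintro _ _ ⟨g, hg, h⟩ ⟨g', hg', h'⟩
    exact ⟨g + g', hg.add hg', fun u => by simp [h, h']⟩
  algebraMap_mem' a := ⟨fun _ => a, analyticOnNhd_const, fun _ => rfl⟩

namespace analyticFunctions

variable {ι σ : Type} [Fintype ι] [Fintype σ] {U : Set (ι → ℝ)} {V : Set (σ → ℝ)} {K : Subfield ℝ}

/-- The `i`-th coordinate function. -/
def coord (U : Set (ι → ℝ)) (i : ι) : analyticFunctions U :=
  ⟨fun u => u.1 i, fun u => u i,
    fun _ _ => (ContinuousLinearMap.proj (R := ℝ) (φ := fun _ : ι => ℝ) i).analyticAt _,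
    fun _ => rfl⟩

/-- Evaluation at a point. -/
def evalAt (u : U) : analyticFunctions U →ₐ[ℝ] ℝ :=
  (Pi.evalAlgHom ℝ (fun _ : U => ℝ) u).comp (analyticFunctions U).val

@[simp] theorem evalAt_apply (u : U) (f : analyticFunctions U) : evalAt u f = f.1 u := rfl

theorem ext_evalAt {f g : analyticFunctions U} (h : ∀ u, evalAt u f = evalAt u g) : f = g :=
  Subtype.ext (funext h)

/-- Polynomials act on analytic functions as polynomial functions. -/
noncomputable instance : Algebra (MvPolynomial ι K) (analyticFunctions U) :=
  (MvPolynomial.aeval (R := K) (coord U)).toRingHom.toAlgebra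

theorem algebraMap_eq (p : MvPolynomial ι K) :
    algebraMap (MvPolynomial ι K) (analyticFunctions U) p = MvPolynomial.aeval (coord U) p := rfl

theorem evalAt_algebraMap (u : U) (p : MvPolynomial ι K) :
    evalAt u (algebraMap (MvPolynomial ι K) (analyticFunctions U) p) =
      MvPolynomial.aeval u.1 p := by
  rw [algebraMap_eq]
  have h := MvPolynomial.map_aeval (R := K) (coord U) ((evalAt u).toRingHom) p
  rw [MvPolynomial.aeval_def, MvPolynomial.coe_eval₂Hom] at *
  exact h

theorem evalAt_aeval (u : U) (q : Polynomial (MvPolynomial ι K)) (f : analyticFunctions U) :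
    evalAt u (Polynomial.aeval f q) =
      q.eval₂ (MvPolynomial.aeval (R := K) u.1).toRingHom (f.1 u) := by
  rw [Polynomial.aeval_def]
  have h := Polynomial.hom_eval₂ q (algebraMap (MvPolynomial ι K) (analyticFunctions U))
    (evalAt u).toRingHom f
  have hr : ((evalAt u).toRingHom.comp (algebraMap (MvPolynomial ι K) (analyticFunctions U))) =
      (MvPolynomial.aeval (R := K) u.1).toRingHom := RingHom.ext fun p => evalAt_algebraMap u p
  exact h.trans (by rw [← hr]; rfl)

theorem isAlgebraic_iff {f : analyticFunctions U} :
    IsAlgebraic (MvPolynomial ι K) f ↔ ∃ q : Polynomial (MvPolynomial ι K), q ≠ 0 ∧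
      ∀ u : U, q.eval₂ (MvPolynomial.aeval (R := K) u.1).toRingHom (f.1 u) = 0 := by
  refine exists_congr fun q => and_congr_right fun _ => ?_
  simp only [← evalAt_aeval]
  exact ⟨fun h u => by rw [h, map_zero], fun h => ext_evalAt fun u => by rw [h, map_zero]⟩

theorem noZeroDivisors (hU : IsOpen U) (hUc : IsPreconnected U) :
    NoZeroDivisors (analyticFunctions U) := by
  refine ⟨?_⟩
  rintro ⟨f, F, hF, hf⟩ ⟨g, G, hG, hg⟩ hfg
  by_contra! hne
  obtain ⟨u, hu⟩ : ∃ u, f u ≠ 0 := by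
    by_contra! h
    exact hne.1 (Subtype.ext (funext h))
  refine hne.2 (Subtype.ext (funext fun v => ?_))
  have hFG : ∀ v ∈ U, F v * G v = 0 := fun v hv => by
    have := congrFun (congrArg Subtype.val hfg) ⟨v, hv⟩
    simpa [hf, hg] using this
  have hG0 : Set.EqOn G 0 U := by
    refine hG.eqOn_of_preconnected_of_eventuallyEq (fun _ _ => analyticAt_const) hUc u.2 ?_
    filter_upwards [(hF u u.2).continuousAt.eventually_ne (hf u ▸ hu), hU.mem_nhds u.2]
      with v hv hvU
    exact (mul_eq_zero.1 (hFG v hvU)).resolve_left hv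
  exact (hg v).trans (hG0 v.2)

/-- An analytic function on a connected open set which is algebraic over the polynomial functions
over `K` and vanishes at a point with coordinates algebraically independent over `K` is zero. -/
theorem eq_zero_of_apply_eq_zero (hU : IsOpen U) (hUc : IsPreconnected U)
    {f : analyticFunctions U} (hf : IsAlgebraic (MvPolynomial ι K) f) (w : U)
    (hw : AlgebraicIndependent K w.1) (h0 : f.1 w = 0) : f = 0 := by
  by_contra hne
  have := noZeroDivisors hU hUc
  obtain ⟨a, ha, b, hab⟩ := hf.exists_nonzero_dvd (mem_nonZeroDivisors_of_ne_zero hne)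
  refine ha (hw.eq_zero_of_aeval_eq_zero a ?_)
  rw [← evalAt_algebraMap w a, hab, map_mul, evalAt_apply, h0, zero_mul]

/-- The pullback of functions under a reindexing of the coordinates. -/
def pullback (e : ι → σ) (he : Set.MapsTo (fun v : σ → ℝ => v ∘ e) V U) (f : analyticFunctions U) :
    analyticFunctions V :=
  ⟨fun v => f.1 ⟨v.1 ∘ e, he v.2⟩, by
    obtain ⟨g, hg, h⟩ := f.2
    refine ⟨fun v => g (v ∘ e), fun v hv => ?_, fun v => h _⟩
    exact AnalyticAt.comp (f := fun v : σ → ℝ => v ∘ e) (hg _ (he hv))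
      ((ContinuousLinearMap.pi fun i =>
        ContinuousLinearMap.proj (R := ℝ) (φ := fun _ : σ => ℝ) (e i)).analyticAt v)⟩

theorem isAlgebraic_pullback {e : ι → σ} (hinj : Function.Injective e)
    (he : Set.MapsTo (fun v : σ → ℝ => v ∘ e) V U) {f : analyticFunctions U}
    (hf : IsAlgebraic (MvPolynomial ι K) f) :
    IsAlgebraic (MvPolynomial σ K) (pullback e he f) := by
  obtain ⟨q, hq, h⟩ := isAlgebraic_iff.1 hf
  refine isAlgebraic_iff.2 ⟨q.map (MvPolynomial.rename e).toRingHom, ?_, fun v => ?_⟩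
  · exact (Polynomial.map_ne_zero_iff (MvPolynomial.rename_injective e hinj)).2 hq
  · rw [Polynomial.eval₂_map]
    convert! h ⟨v.1 ∘ e, he v.2⟩ using 2
    ext p
    · simp
    · simp

theorem isAlgebraic_aeval {J : Type} (p : MvPolynomial J K) (f : J → analyticFunctions U)
    (hf : ∀ j, IsAlgebraic (MvPolynomial ι K) (f j)) :
    IsAlgebraic (MvPolynomial ι K) (MvPolynomial.aeval f p) := by
  induction p using MvPolynomial.induction_on with
  | C a =>
    have : MvPolynomial.aeval f (MvPolynomial.C a) =
        algebraMap (MvPolynomial ι K) (analyticFunctions U) (MvPolynomial.C a) := by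
      simp [algebraMap_eq]
    rw [this]
    exact isAlgebraic_algebraMap _
  | add p q hp hq => rw [map_add]; exact hp.add hq
  | mul_X p j hp => rw [map_mul, MvPolynomial.aeval_X]; exact hp.mul (hf j)

end analyticFunctions

/-- An algebraic function of algebraically independent reals is locally given by an analytic
function satisfying the same kind of polynomial equation. -/
theorem exists_analytic_branch {ι : Type} [Fintype ι] {K : Subfield ℝ} {t : ι → ℝ}
    (ht : AlgebraicIndependent K t) {y : ℝ}
    (hy : ∃ q : Polynomial (MvPolynomial ι K), q ≠ 0 ∧
      q.eval₂ (MvPolynomial.aeval (R := K) t).toRingHom y = 0) :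
    ∃ h : (ι → ℝ) → ℝ, h t = y ∧ ∃ q : Polynomial (MvPolynomial ι K), q ≠ 0 ∧
      ∀ᶠ u in nhds t, AnalyticAt ℝ h u ∧
        q.eval₂ (MvPolynomial.aeval (R := K) u).toRingHom (h u) = 0 := by
  classical
  have hdeg : ∃ d, ∃ q : Polynomial (MvPolynomial ι K), q.natDegree = d ∧ q ≠ 0 ∧
      q.eval₂ (MvPolynomial.aeval (R := K) t).toRingHom y = 0 := by
    obtain ⟨q, hq, hqy⟩ := hy
    exact ⟨_, q, rfl, hq, hqy⟩
  obtain ⟨q, hqd, hq, hqy⟩ := Nat.find_spec hdeg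
  have hd0 : q.natDegree ≠ 0 := by
    intro h
    obtain ⟨c, rfl⟩ := Polynomial.natDegree_eq_zero.1 h
    rw [Polynomial.eval₂_C] at hqy
    exact hq (by rw [ht.eq_zero_of_aeval_eq_zero c hqy, map_zero])
  have hder : q.derivative.eval₂ (MvPolynomial.aeval (R := K) t).toRingHom y ≠ 0 := by
    intro h
    refine Nat.find_min hdeg (hqd ▸ Polynomial.natDegree_derivative_lt hd0) ⟨_, rfl, ?_, h⟩
    exact fun h => hd0 (Polynomial.derivative_eq_zero.1 h)
  let F : (ι → ℝ) × ℝ → ℝ := fun z =>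
    q.eval₂ (MvPolynomial.aeval (R := K) z.1).toRingHom z.2
  have hF : AnalyticAt ℝ F (t, y) := by
    have hsum : F = fun z => ∑ i ∈ Finset.range (q.natDegree + 1),
        MvPolynomial.aeval z.1 (q.coeff i) * z.2 ^ i :=
      funext fun z => Polynomial.eval₂_eq_sum_range _ _
    rw [hsum]
    refine Finset.analyticAt_fun_sum _ fun i _ => ?_
    refine (AnalyticAt.aeval_mvPolynomial (fun j => ?_) _).mul (analyticAt_snd.pow i)
    exact ((ContinuousLinearMap.proj (R := ℝ) (φ := fun _ : ι => ℝ) j).comp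
      (ContinuousLinearMap.fst ℝ (ι → ℝ) ℝ)).analyticAt _
  have hinv : (fderiv ℝ F (t, y) ∘L .inr ℝ (ι → ℝ) ℝ).IsInvertible := by
    have h1 : HasDerivAt (fun z => F (t, z))
        (q.derivative.eval₂ (MvPolynomial.aeval (R := K) t).toRingHom y) y := by
      simp only [F, Polynomial.eval₂_eq_eval_map, ← Polynomial.derivative_map]
      exact Polynomial.hasDerivAt _ _
    have h2 : HasFDerivAt (fun z => F (t, z)) (fderiv ℝ F (t, y) ∘L .inr ℝ (ι → ℝ) ℝ) y :=
      hF.differentiableAt.hasFDerivAt.comp y (hasFDerivAt_prodMk_right t y)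
    refine ⟨ContinuousLinearEquiv.unitsEquivAut ℝ (Units.mk0 _ hder), ?_⟩
    rw [← h1.hasFDerivAt.unique h2]
    ext
    simp
  have hω : (⊤ : WithTop ℕ∞) ≠ 0 := by simp
  have hc : ContDiffAt ℝ ⊤ F (t, y) := hF.contDiffAt
  refine ⟨hc.implicitFunction hω hinv, hc.implicitFunction_apply_self hω hinv, q, hq, ?_⟩
  filter_upwards [hc.eventually_apply_implicitFunction hω hinv,
    (hc.contDiffAt_implicitFunction hω hinv).analyticAt.eventually_analyticAt] with u hu hu'
  exact ⟨hu', hu.trans hqy⟩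

/-- An open box with rational vertices. -/
def rationalBox {r : ℕ} (b : Fin r → ℚ × ℚ) : Set (Fin r → ℝ) :=
  Set.univ.pi fun i => Set.Ioo ((b i).1 : ℝ) (b i).2

theorem mem_rationalBox {r : ℕ} {b : Fin r → ℚ × ℚ} {u : Fin r → ℝ} :
    u ∈ rationalBox b ↔ ∀ i, u i ∈ Set.Ioo ((b i).1 : ℝ) (b i).2 :=
  Set.mem_univ_pi

theorem isOpen_rationalBox {r : ℕ} (b : Fin r → ℚ × ℚ) : IsOpen (rationalBox b) :=
  isOpen_set_pi Set.finite_univ fun _ _ => isOpen_Ioo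

theorem isPreconnected_rationalBox {r : ℕ} (b : Fin r → ℚ × ℚ) :
    IsPreconnected (rationalBox b) :=
  (convex_pi fun _ _ => convex_Ioo _ _).isPreconnected

theorem exists_rationalBox_subset {r : ℕ} {t : Fin r → ℝ} {U : Set (Fin r → ℝ)} (hU : U ∈ nhds t) :
    ∃ b, t ∈ rationalBox b ∧ rationalBox b ⊆ U := by
  obtain ⟨ε, hε, hball⟩ := Metric.mem_nhds_iff.1 hU
  choose c hc hc' using fun i => exists_rat_btwn (sub_lt_self (t i) hε)
  choose d hd hd' using fun i => exists_rat_btwn (lt_add_of_pos_right (t i) hε)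
  refine ⟨fun i => (c i, d i), mem_rationalBox.2 fun i => ⟨hc' i, hd i⟩, fun u hu => hball ?_⟩
  rw [Metric.mem_ball, dist_pi_lt_iff hε]
  intro i
  have h := mem_rationalBox.1 hu i
  rw [Real.dist_eq, abs_lt]
  constructor <;> linarith [hc i, hd' i, h.1, h.2]

theorem exists_fin_map_rename {T : Type} {K : Subfield ℝ} {n : ℕ}
    (q : Fin n → Polynomial (MvPolynomial T K)) :
    ∃ (r : ℕ) (τ : Fin r → T) (q' : Fin n → Polynomial (MvPolynomial (Fin r) K)),
      Function.Injective τ ∧ ∀ l, (q' l).map (MvPolynomial.rename τ).toRingHom = q l := by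
  classical
  let S : Finset T :=
    Finset.univ.biUnion fun l => (q l).support.biUnion fun i => ((q l).coeff i).vars
  have hS : Set.range ((↑) ∘ S.equivFin.symm : Fin S.card → T) = S := by
    rw [Set.range_comp, S.equivFin.symm.range_eq_univ, Set.image_univ, Subtype.range_coe]
  have hinj : Function.Injective ((↑) ∘ S.equivFin.symm : Fin S.card → T) :=
    Subtype.val_injective.comp S.equivFin.symm.injective
  have hq : ∀ l, ∃ q' : Polynomial (MvPolynomial (Fin S.card) K),
      q'.map (MvPolynomial.rename ((↑) ∘ S.equivFin.symm)).toRingHom = q l := by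
    intro l
    refine (Polynomial.mem_lifts _).1 ((Polynomial.lifts_iff_coeff_lifts _).2 fun i => ?_)
    by_cases hi : i ∈ (q l).support
    · refine MvPolynomial.exists_rename_eq_of_vars_subset_range _ _ hinj ?_
      rw [hS]
      intro s hs
      simp only [S, Finset.coe_biUnion, Set.mem_iUnion]
      exact ⟨l, Finset.mem_univ l, i, hi, hs⟩
    · exact ⟨0, by rw [Polynomial.notMem_support_iff.1 hi, map_zero]⟩
  choose q' hmap using hq
  exact ⟨_, _, q', hinj, hmap⟩

/-- Every point of `ℝⁿ` is the value of an `n`-tuple of analytic algebraic functions at finitely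
many members of a transcendence basis. -/
theorem exists_representation {T : Type} {K : Subfield ℝ} {x : T → ℝ}
    (hx : IsTranscendenceBasis K x) {n : ℕ} (a : Fin n → ℝ) :
    ∃ (r : ℕ) (τ : Fin r → T) (b : Fin r → ℚ × ℚ)
      (g : Fin n → {f : analyticFunctions (rationalBox b) //
        IsAlgebraic (MvPolynomial (Fin r) K) f}),
      rationalBox b ⊆ {u | Function.Injective u} ∧
      ∃ h : x ∘ τ ∈ rationalBox b, ∀ l, (g l).1.1 ⟨x ∘ τ, h⟩ = a l := by
  have halg := hx.isAlgebraic
  have hq : ∀ l, ∃ q : Polynomial (MvPolynomial T K), q ≠ 0 ∧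
      q.eval₂ (MvPolynomial.aeval (R := K) x).toRingHom (a l) = 0 := by
    intro l
    obtain ⟨q, hq, hq0⟩ := halg.isAlgebraic (a l)
    refine ⟨q.map hx.1.aevalEquiv.symm.toRingEquiv.toRingHom, ?_, ?_⟩
    · exact (Polynomial.map_ne_zero_iff hx.1.aevalEquiv.symm.injective).2 hq
    · rw [Polynomial.eval₂_map]
      rw [Polynomial.aeval_def] at hq0
      convert! hq0 using 2
      ext c
      exact (hx.1.algebraMap_aevalEquiv _).symm.trans
        (congrArg _ (hx.1.aevalEquiv.apply_symm_apply c))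
  choose q hq hq0 using hq
  obtain ⟨r, τ, q', hτ, hq'⟩ := exists_fin_map_rename q
  have ht : AlgebraicIndependent K (x ∘ τ) := hx.1.comp τ hτ
  choose g hg Q hQ hev using fun l => exists_analytic_branch (y := a l) ht
    ⟨q' l, by
      rintro h
      exact hq l (by rw [← hq' l, h, Polynomial.map_zero]), by
      have h := hq0 l
      rw [← hq' l, Polynomial.eval₂_map] at h
      convert! h using 2
      ext p <;> simp⟩
  have hopen : IsOpen {u : Fin r → ℝ | Function.Injective u} := by
    have : {u : Fin r → ℝ | Function.Injective u} = ⋂ i, ⋂ j, {u | i ≠ j → u i ≠ u j} := by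
      ext u
      simp only [Set.mem_iInter, Set.mem_ofPred_eq, Function.Injective]
      exact forall₂_congr fun i j => not_imp_not.symm
    rw [this]
    refine isOpen_iInter_of_finite fun i => isOpen_iInter_of_finite fun j => ?_
    by_cases hij : i = j
    · simp [hij]
    · simpa [hij] using isOpen_ne_fun (continuous_apply i) (continuous_apply j)
  obtain ⟨b, htb, hb⟩ := exists_rationalBox_subset
    ((hopen.eventually_mem (hx.1.injective.comp hτ)).and (Filter.eventually_all.2 hev))
  refine ⟨r, τ, b, fun l => ⟨⟨fun u => g l u, g l, fun u hu => ((hb hu).2 l).1, fun _ => rfl⟩, ?_⟩,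
    fun u hu => (hb hu).1, htb, fun l => hg l⟩
  exact analyticFunctions.isAlgebraic_iff.2 ⟨Q l, hQ l, fun u => ((hb u.2).2 l).2⟩

/-- A polynomial relation over `K` between values of analytic algebraic functions at tuples of
algebraically independent reals persists when these reals are replaced by arbitrary reals from the
same intervals. -/
theorem aeval_eq_zero_of_algebraicIndependent {K : Subfield ℝ} {r n : ℕ} {b : Fin r → ℚ × ℚ}
    {J M : Type} [Finite J] (m : J → Fin r → M) {g : Fin n → analyticFunctions (rationalBox b)}
    (hg : ∀ l, IsAlgebraic (MvPolynomial (Fin r) K) (g l)) (p : MvPolynomial (J × Fin n) K)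
    {w : Fin r → M → ℝ} (hw : ∀ j, (fun i => w i (m j i)) ∈ rationalBox b)
    (hind : AlgebraicIndependent K
      fun s : Set.range (fun s : J × Fin r => (s.2, m s.1 s.2)) => w s.1.1 s.1.2)
    (h0 : MvPolynomial.aeval (fun s : J × Fin n => (g s.2).1 ⟨_, hw s.1⟩) p = 0)
    {β : Fin r → M → ℝ} (hβ : ∀ j, (fun i => β i (m j i)) ∈ rationalBox b) :
    MvPolynomial.aeval (fun s : J × Fin n => (g s.2).1 ⟨_, hβ s.1⟩) p = 0 := by
  let σ := Set.range (fun s : J × Fin r => (s.2, m s.1 s.2))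
  let _ : Fintype σ := Fintype.ofFinite σ
  let V : Set (σ → ℝ) := Set.univ.pi fun s => Set.Ioo ((b s.1.1).1 : ℝ) (b s.1.1).2
  have hV : IsOpen V := isOpen_set_pi Set.finite_univ fun _ _ => isOpen_Ioo
  have hVc : IsPreconnected V := (convex_pi fun _ _ => convex_Ioo _ _).isPreconnected
  let e : J → Fin r → σ := fun j i => ⟨(i, m j i), (j, i), rfl⟩
  have he : ∀ j, Function.Injective (e j) := fun j i i' h =>
    congrArg (fun s : σ => s.1.1) h
  have hmaps : ∀ j, Set.MapsTo (fun v : σ → ℝ => v ∘ e j) V (rationalBox b) := fun j v hv =>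
    mem_rationalBox.2 fun i => hv (e j i) (Set.mem_univ _)
  have hmem : ∀ γ : Fin r → M → ℝ, (∀ j, (fun i => γ i (m j i)) ∈ rationalBox b) →
      (fun s : σ => γ s.1.1 s.1.2) ∈ V := by
    rintro γ hγ ⟨_, ⟨j, i⟩, rfl⟩ -
    exact mem_rationalBox.1 (hγ j) i
  let f : J × Fin n → analyticFunctions V := fun s =>
    analyticFunctions.pullback (e s.1) (hmaps s.1) (g s.2)
  have hf : IsAlgebraic (MvPolynomial σ K) (MvPolynomial.aeval f p) :=
    analyticFunctions.isAlgebraic_aeval p f fun s =>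
      analyticFunctions.isAlgebraic_pullback (he s.1) (hmaps s.1) (hg s.2)
  have heval : ∀ v : V, (MvPolynomial.aeval f p).1 v =
      MvPolynomial.aeval (fun s => (f s).1 v) p := fun v =>
    MvPolynomial.comp_aeval_apply f ((analyticFunctions.evalAt v).restrictScalars K) p
  have hzero := analyticFunctions.eq_zero_of_apply_eq_zero hV hVc hf ⟨_, hmem w hw⟩ hind
    ((heval _).trans h0)
  have := heval ⟨_, hmem β hβ⟩
  rw [hzero] at this
  exact this.symm

/-- The coordinates on which a function on a box depends. -/
def essentialCoords {r : ℕ} {b : Fin r → ℚ × ℚ} {Y : Type} (G : rationalBox b → Y) : Set (Fin r) :=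
  {i | ∃ v v' : rationalBox b, (∀ j ≠ i, v.1 j = v'.1 j) ∧ G v ≠ G v'}

theorem eq_of_eqOn_essentialCoords {r : ℕ} {b : Fin r → ℚ × ℚ} {Y : Type} {G : rationalBox b → Y}
    {v v' : rationalBox b} (h : ∀ i ∈ essentialCoords G, v.1 i = v'.1 i) : G v = G v' := by
  classical
  suffices H : ∀ s : Finset (Fin r), ∀ v : rationalBox b,
      (∀ i ∈ essentialCoords G, v.1 i = v'.1 i) → (∀ i ∉ s, v.1 i = v'.1 i) → G v = G v' from
    H Finset.univ v h fun i hi => absurd (Finset.mem_univ i) hi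
  intro s
  induction s using Finset.induction_on with
  | empty => exact fun v _ hv => congrArg G (Subtype.ext (funext fun i => hv i (by simp)))
  | insert i s _ ih =>
    intro v hv hvs
    have hu : Function.update v.1 i (v'.1 i) ∈ rationalBox b := by
      refine mem_rationalBox.2 fun j => ?_
      rcases eq_or_ne j i with rfl | hj
      · simpa using mem_rationalBox.1 v'.2 j
      · simpa [hj] using mem_rationalBox.1 v.2 j
    have h1 : G v = G ⟨_, hu⟩ := by
      by_contra hne
      have hi : i ∈ essentialCoords G :=
        ⟨v, ⟨_, hu⟩, fun j hj => (Function.update_of_ne hj _ _).symm, hne⟩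
      refine hne (congrArg G (Subtype.ext ?_))
      simp [← hv i hi]
    rw [h1]
    refine ih _ (fun j hj => ?_) fun j hj => ?_
    · rcases eq_or_ne j i with rfl | hji
      · exact Function.update_self ..
      · exact (Function.update_of_ne hji _ _).trans (hv j hj)
    · rcases eq_or_ne j i with rfl | hji
      · exact Function.update_self ..
      · exact (Function.update_of_ne hji _ _).trans (hvs j (by simp [hji, hj]))

theorem AlgebraicIndependent.add_algebraMap {ι R A : Type} [CommRing R] [CommRing A] [Algebra R A]
    {x : ι → A} (hx : AlgebraicIndependent R x) (c : ι → R) :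
    AlgebraicIndependent R fun i => x i + algebraMap R A (c i) := by
  have hcomp : MvPolynomial.aeval (fun i => x i + algebraMap R A (c i)) =
      (MvPolynomial.aeval x).comp
        (MvPolynomial.aeval fun i => MvPolynomial.X i + MvPolynomial.C (c i)) := by
    ext i
    simp
  have hinv : (MvPolynomial.aeval fun i => MvPolynomial.X i - MvPolynomial.C (c i)).comp
      (MvPolynomial.aeval (R := R) fun i => MvPolynomial.X i + MvPolynomial.C (c i)) =
        AlgHom.id R (MvPolynomial ι R) := by
    ext i
    simp
  rw [algebraicIndependent_iff_injective_aeval, hcomp, AlgHom.coe_comp]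
  refine (algebraicIndependent_iff_injective_aeval.1 hx).comp fun q q' h => ?_
  rw [← AlgHom.id_apply (R := R) q, ← AlgHom.id_apply (R := R) q', ← hinv, AlgHom.comp_apply,
    AlgHom.comp_apply, h]

/-- Many algebraically independent reals can be found inside given intervals. -/
theorem exists_algebraicIndependent_mem_Ioo {T : Type} [Infinite T] {K : Subfield ℝ} {x : T → ℝ}
    (hx : AlgebraicIndependent K x) {r : ℕ} {b : Fin r → ℚ × ℚ} (hb : (rationalBox b).Nonempty) :
    ∃ w : Fin r → T → ℝ, (∀ i t, w i t ∈ Set.Ioo ((b i).1 : ℝ) (b i).2) ∧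
      AlgebraicIndependent K fun s : Fin r × T => w s.1 s.2 := by
  obtain ⟨u, hu⟩ := hb
  have hcard : #(Fin r × T) ≤ #T := by
    rw [Cardinal.mk_prod, Cardinal.lift_id, Cardinal.lift_id]
    exact Cardinal.mul_le_of_le (Cardinal.aleph0_le_mk T)
      ((Cardinal.lt_aleph0_of_finite _).le.trans (Cardinal.aleph0_le_mk T)) le_rfl
  obtain ⟨f⟩ := Cardinal.le_def _ _ |>.1 hcard
  have hq : ∀ s : Fin r × T, ∃ q : ℚ, x (f s) + q ∈ Set.Ioo ((b s.1).1 : ℝ) (b s.1).2 := by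
    intro s
    have hs := mem_rationalBox.1 hu s.1
    obtain ⟨q, hq, hq'⟩ := exists_rat_btwn
      (sub_lt_sub_right (hs.1.trans hs.2) (x (f s)))
    exact ⟨q, by linarith, by linarith⟩
  choose q hq using hq
  refine ⟨fun i t => x (f (i, t)) + q (i, t), fun i t => hq (i, t), ?_⟩
  have h := (hx.comp f f.injective).add_algebraMap fun s => (q s : K)
  simpa using h

theorem exists_monochromatic_map {κ : Cardinal} (hκ : ℵ₀ ≤ κ) {C : Type} (hC : #C ≤ κ) {T : Type}
    {r : ℕ} (I : Finset (Fin r)) (hI : cardSucc κ I.card ≤ #T) (M : Set T) [Finite M]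
    (c : (Fin r → T) → C) :
    ∃ Y : Fin r → T → T, (∀ i ∈ I, Set.InjOn (Y i) M) ∧
      ∃ a, ∀ t : Fin r → T, (∀ i, t i ∈ M) → c (fun i => Y i (t i)) = a := by
  classical
  have hT : Nonempty T := by
    rw [← Cardinal.mk_ne_zero_iff]
    exact (Cardinal.aleph0_pos.trans_le ((hκ.trans (le_cardSucc κ _)).trans hI)).ne'
  obtain ⟨t₀⟩ := hT
  obtain ⟨y, hy, a, ha⟩ := exists_monochromatic_box hκ hC M I.card T hI fun v =>
    c fun i => if h : i ∈ I then v (I.equivFin ⟨i, h⟩) else t₀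
  refine ⟨fun i t => if h : i ∈ I then
    if ht : t ∈ M then y (I.equivFin ⟨i, h⟩) ⟨t, ht⟩ else t₀ else t₀, ?_, a, ?_⟩
  · intro i hi s hs t ht hst
    simp only [hi, hs, ht, dite_true] at hst
    exact congrArg Subtype.val (hy _ hst)
  · intro t ht
    rw [← ha fun m => ⟨t (I.equivFin.symm m).1, ht _⟩]
    refine congrArg c (funext fun i => ?_)
    by_cases hi : i ∈ I
    · simp [hi, ht]
    · simp [hi]

/-- If pairwise distinct tuples of members of `x` are separated on few coordinates, then any
polynomial relation between the values of `g` at these tuples also holds between suitable distinct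
values of `g` that lie in one color class. -/
theorem exists_monochromatic_zero {κ : Cardinal} (hκ : ℵ₀ ≤ κ) {C : Type} (hC : #C ≤ κ)
    {K : Subfield ℝ} {T : Type} [Infinite T] {x : T → ℝ} (hx : AlgebraicIndependent K x)
    {r n k : ℕ} {b : Fin r → ℚ × ℚ} (hb : rationalBox b ⊆ {u | Function.Injective u})
    {g : Fin n → analyticFunctions (rationalBox b)}
    (hg : ∀ l, IsAlgebraic (MvPolynomial (Fin r) K) (g l))
    {τ : Fin k → Fin r → T} (hτ : ∀ j, x ∘ τ j ∈ rationalBox b)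
    {I : Finset (Fin r)} (hI : cardSucc κ I.card ≤ #T)
    (hsep : ∀ j j', j ≠ j' → ∃ i ∈ I,
      i ∈ essentialCoords (fun v l => (g l).1 v) ∧ τ j i ≠ τ j' i)
    {p : MvPolynomial (Fin k × Fin n) K}
    (hp : MvPolynomial.aeval (fun s : Fin k × Fin n => (g s.2).1 ⟨_, hτ s.1⟩) p = 0)
    (c : (Fin n → ℝ) → C) :
    ∃ z : Fin k → Fin n → ℝ, Function.Injective z ∧
      MvPolynomial.aeval (fun s : Fin k × Fin n => z s.1 s.2) p = 0 ∧ ∃ a, ∀ j, c (z j) = a := by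
  classical
  rcases isEmpty_or_nonempty (Fin k) with hk | ⟨⟨j₀⟩⟩
  · obtain ⟨z⟩ : Nonempty (Fin k → Fin n → ℝ) := inferInstance
    refine ⟨z, Function.injective_of_subsingleton z, ?_, c 0, fun j => hk.elim j⟩
    rw [← hp]
    exact congrArg (fun f => MvPolynomial.aeval f p) (funext fun s => hk.elim s.1)
  obtain ⟨w, hwb, hw⟩ := exists_algebraicIndependent_mem_Ioo hx ⟨_, hτ j₀⟩
  have hwbox : ∀ t : Fin r → T, (fun i => w i (t i)) ∈ rationalBox b := fun t =>
    mem_rationalBox.2 fun i => hwb i (t i)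
  obtain ⟨Y, hY, a, ha⟩ := exists_monochromatic_map hκ hC I hI
    (Set.range fun s : Fin k × Fin r => τ s.1 s.2)
    (fun t => c fun l => (g l).1 ⟨fun i => w i (t i), hwbox t⟩)
  refine ⟨fun j l => (g l).1 ⟨fun i => w i (Y i (τ j i)), hwbox _⟩, ?_, ?_, a,
    fun j => ha (τ j) fun i => ⟨(j, i), rfl⟩⟩
  · intro j j' hz
    by_contra hjj
    obtain ⟨i₀, hi₀, ⟨v, v', hvv, hne⟩, hτi⟩ := hsep j j' hjj
    have hYi : Y i₀ (τ j i₀) ≠ Y i₀ (τ j' i₀) := fun h =>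
      hτi (hY i₀ hi₀ ⟨(j, i₀), rfl⟩ ⟨(j', i₀), rfl⟩ h)
    refine hne (funext fun l => ?_)
    let β : Fin r → T → ℝ := fun i t => if i = i₀ ∧ t = Y i₀ (τ j' i₀) then v'.1 i else v.1 i
    have hβ : ∀ m, (fun i => β i (Y i (τ m i))) ∈ rationalBox b := fun m =>
      mem_rationalBox.2 fun i => by
        by_cases h : i = i₀ ∧ Y i (τ m i) = Y i₀ (τ j' i₀)
        · simpa only [β, if_pos h] using mem_rationalBox.1 v'.2 i
        · simpa only [β, if_neg h] using mem_rationalBox.1 v.2 i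
    have h := aeval_eq_zero_of_algebraicIndependent (fun m i => Y i (τ m i)) hg
      (MvPolynomial.X (j, l) - MvPolynomial.X (j', l)) (w := w) (fun m => hwbox _)
      (hw.comp Subtype.val Subtype.val_injective) (by
        rw [map_sub, MvPolynomial.aeval_X, MvPolynomial.aeval_X]
        exact sub_eq_zero.2 (congrFun hz l)) hβ
    rw [map_sub, MvPolynomial.aeval_X, MvPolynomial.aeval_X, sub_eq_zero] at h
    have hv : (⟨_, hβ j⟩ : rationalBox b) = v := Subtype.ext <| funext fun i => by
      refine if_neg ?_
      rintro ⟨rfl, h⟩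
      exact hYi h
    have hv' : (⟨_, hβ j'⟩ : rationalBox b) = v' := Subtype.ext <| funext fun i => by
      by_cases hi : i = i₀
      · subst hi
        exact if_pos ⟨rfl, rfl⟩
      · exact (if_neg fun h => hi h.1).trans (hvv i hi)
    simpa only [hv, hv'] using h
  · refine aeval_eq_zero_of_algebraicIndependent τ hg p (w := fun _ t => x t) hτ ?_ hp
      (β := fun i t => w i (Y i t)) fun j => hwbox fun i => Y i (τ j i)
    refine hx.comp (fun s : Set.range (fun s : Fin k × Fin r => (s.2, τ s.1 s.2)) => s.1.2) ?_
    rintro ⟨_, ⟨j, i⟩, rfl⟩ ⟨_, ⟨j', i'⟩, rfl⟩ (h : τ j i = τ j' i')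
    have hii : i = i' := by
      by_contra hii
      have hu : Function.update (x ∘ τ j) i' (x (τ j' i')) ∈ rationalBox b := by
        refine mem_rationalBox.2 fun m => ?_
        rcases eq_or_ne m i' with rfl | hm
        · simpa using mem_rationalBox.1 (hτ j') m
        · simpa [hm] using mem_rationalBox.1 (hτ j) m
      refine hii (hb hu ?_)
      simp [hii, h]
    subst hii
    exact Subtype.ext (Prod.ext rfl h)

/-- The tuples of analytic algebraic functions on boxes. -/
abbrev AlgebraicTuple (K : Subfield ℝ) (n : ℕ) : Type :=
  Σ (r : ℕ) (b : Fin r → ℚ × ℚ),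
    Fin n → {f : analyticFunctions (rationalBox b) // IsAlgebraic (MvPolynomial (Fin r) K) f}

theorem analyticFunctions.isTorsionFree_rationalBox {K : Subfield ℝ} {r : ℕ} {b : Fin r → ℚ × ℚ}
    (hb : (rationalBox b).Nonempty) :
    Module.IsTorsionFree (MvPolynomial (Fin r) K) (analyticFunctions (rationalBox b)) := by
  have := analyticFunctions.noZeroDivisors (isOpen_rationalBox b) (isPreconnected_rationalBox b)
  have : Nonempty (rationalBox b) := hb.to_subtype
  have : IsDomain (analyticFunctions (rationalBox b)) := NoZeroDivisors.to_isDomain _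
  obtain ⟨u, hu⟩ := hb
  refine Module.isTorsionFree_iff_algebraMap_injective.2 fun q q' h => ?_
  refine MvPolynomial.map_injective K.subtype K.subtype.injective ?_
  refine MvPolynomial.funext_set (fun i => Set.Ioo ((b i).1 : ℝ) (b i).2) (fun i => ?_)
    fun v hv => ?_
  · have hi := mem_rationalBox.1 hu i
    exact Set.Ioo_infinite (hi.1.trans hi.2)
  · have h' := congrArg (analyticFunctions.evalAt (⟨v, hv⟩ : rationalBox b)) h
    rw [analyticFunctions.evalAt_algebraMap, analyticFunctions.evalAt_algebraMap] at h'
    rw [MvPolynomial.eval_map, MvPolynomial.eval_map]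
    exact h'

theorem mk_algebraicTuple_le {K : Subfield ℝ} {κ : Cardinal} (hκ : ℵ₀ ≤ κ) (hK : #K ≤ κ) (n : ℕ) :
    #(AlgebraicTuple K n) ≤ κ := by
  have key : ∀ {ι : Type} [Countable ι] (B : ι → Type), (∀ i, #(B i) ≤ κ) → #(Σ i, B i) ≤ κ := by
    intro ι _ B hB
    rw [Cardinal.mk_sigma]
    refine (Cardinal.sum_le_sum _ (fun _ => κ) hB).trans ?_
    rw [Cardinal.sum_const']
    exact Cardinal.mul_le_of_le hκ ((Cardinal.mk_le_aleph0).trans hκ) le_rfl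
  refine key _ fun r => key _ fun b => mk_pi_le_of_finite hκ ?_
  rcases (rationalBox b).eq_empty_or_nonempty with hb | ⟨u, hu⟩
  · have : IsEmpty (rationalBox b) := Set.isEmpty_coe_sort.2 hb
    exact (Cardinal.le_one_iff_subsingleton.2 inferInstance).trans
      (Cardinal.one_lt_aleph0.le.trans hκ)
  · have := analyticFunctions.noZeroDivisors (isOpen_rationalBox b) (isPreconnected_rationalBox b)
    have : Nonempty (rationalBox b) := ⟨⟨u, hu⟩⟩
    have : IsDomain (analyticFunctions (rationalBox b)) := NoZeroDivisors.to_isDomain _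
    have := analyticFunctions.isTorsionFree_rationalBox (K := K) ⟨u, hu⟩
    refine (Algebraic.cardinalMk_le_max _ _).trans (max_le ?_ hκ)
    refine MvPolynomial.cardinalMk_le_max.trans (max_le (max_le hK ?_) hκ)
    exact Cardinal.mk_le_aleph0.trans hκ

theorem mk_transcendenceBasis {K : Subfield ℝ} (hK : #K < 𝔠) {T : Type} {x : T → ℝ}
    (hx : IsTranscendenceBasis K x) : #T = 𝔠 := by
  refine le_antisymm (Cardinal.mk_real ▸ Cardinal.mk_le_of_injective hx.1.injective) ?_
  by_contra! hT
  have := hx.isAlgebraic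
  have h1 := Algebra.IsAlgebraic.cardinalMk_le_max (Algebra.adjoin K (Set.range x)) ℝ
  have h2 := Algebra.cardinalMk_adjoin_le K (Set.range x)
  have h3 : #(Set.range x) < 𝔠 := Cardinal.mk_range_le.trans_lt hT
  rw [Cardinal.mk_real] at h1
  exact h1.not_gt (max_lt (h2.trans_lt (max_lt (max_lt hK h3) Cardinal.aleph0_lt_continuum))
    Cardinal.aleph0_lt_continuum)

theorem exists_ne_of_mem_zeroEdges {n k : ℕ} (hk : 2 ≤ k) {p : MvPolynomial (Fin k × Fin n) ℝ}
    {e : Set (Fin n → ℝ)} (he : e ∈ zeroEdges p) : ∃ x ∈ e, ∃ y ∈ e, x ≠ y := by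
  obtain ⟨a, ha, rfl, -⟩ := he
  refine ⟨_, ⟨⟨0, by omega⟩, rfl⟩, _, ⟨⟨1, by omega⟩, rfl⟩, fun h => ?_⟩
  simpa using ha h

/-- Families of at most `κ` polynomials are defined over a subfield of size at most `κ`. -/
theorem exists_subfield_map_eq {κ : Cardinal} (hκ : ℵ₀ ≤ κ) {A : Type} (hA : #A ≤ κ) {σ : A → Type}
    (p : ∀ α, MvPolynomial (σ α) ℝ) :
    ∃ K : Subfield ℝ, #K ≤ κ ∧
      ∀ α, ∃ q : MvPolynomial (σ α) K, MvPolynomial.map K.subtype q = p α := by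
  refine ⟨Subfield.closure (⋃ α, ((p α).coeffs : Set ℝ)), ?_, fun α => ?_⟩
  · refine (Subfield.cardinalMk_closure_le_max _).trans (max_le ?_ hκ)
    refine Cardinal.mk_iUnion_le_sum_mk.trans
      ((Cardinal.sum_le_sum _ (fun _ => κ) fun α => ?_).trans ?_)
    · exact (Cardinal.lt_aleph0_of_finite _).le.trans hκ
    · rw [Cardinal.sum_const']
      exact Cardinal.mul_le_of_le hκ hA le_rfl
  · refine MvPolynomial.mem_range_map_iff_coeffs_subset.2 fun c hc => ?_
    exact ⟨⟨c, Subfield.subset_closure (Set.mem_iUnion.2 ⟨α, hc⟩)⟩, rfl⟩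

/-- Corollary 2.6: master colorings exist.  Given at most `κ`
many algebraic hypergraphs on `ℝⁿ`, each of chromatic number at most `κ`
(`κ` infinite), one function properly colors all of them simultaneously. -/
theorem statement4 (n : ℕ) (hn : 1 ≤ n) (κ : Cardinal) (hκ : Cardinal.aleph0 ≤ κ)
    (A : Type) (hA : #A ≤ κ) (k : A → ℕ) (hk : ∀ α, 2 ≤ k α)
    (p : ∀ α, MvPolynomial (Fin (k α) × Fin n) ℝ)
    (hchr : ∀ α, chrNum (zeroEdges (p α)) ≤ κ) :
    ∃ (C : Type) (φ : (Fin n → ℝ) → C), #C ≤ κ ∧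
      ∀ α, ∀ e ∈ zeroEdges (p α), ∃ x ∈ e, ∃ y ∈ e, φ x ≠ φ y := by
  classical
  rcases le_or_gt 𝔠 κ with hcκ | hκc
  · exact ⟨_, id, mk_pi_le_of_finite hκ (Cardinal.mk_real.trans_le hcκ),
      fun α e he => exists_ne_of_mem_zeroEdges (hk α) he⟩
  obtain ⟨K, hK, hq⟩ := exists_subfield_map_eq hκ hA p
  choose q hq using hq
  have haeval : ∀ α (a : Fin (k α) × Fin n → ℝ),
      MvPolynomial.aeval a (q α) = MvPolynomial.eval a (p α) := fun α a => by
    rw [← hq α, MvPolynomial.eval_map]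
    rfl
  obtain ⟨T, x, hx⟩ := exists_isTranscendenceBasis' K ℝ
  have hT : #T = 𝔠 := mk_transcendenceBasis (hK.trans_lt hκc) hx
  have : Infinite T := Cardinal.infinite_iff.2 (hT ▸ Cardinal.aleph0_le_continuum)
  obtain ⟨t₀⟩ : Nonempty T := inferInstance
  choose ψ D hD hψ using exists_coloring_cardSucc_le hκ (hκc.le.trans_eq hT.symm) (le_refl #T)
  let F (s : AlgebraicTuple K n) (v : rationalBox s.2.1) (l : Fin n) : ℝ := (s.2.2 l).1.1 v
  let restrict (s : AlgebraicTuple K n) (τ : Fin s.1 → T) : Fin s.1 → T := fun i =>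
    if i ∈ essentialCoords (F s) then τ i else t₀
  have hcol : ∀ a, ∃ c : AlgebraicTuple K n × κ.out, ∃ τ : Fin c.1.1 → T,
      rationalBox c.1.2.1 ⊆ {u | Function.Injective u} ∧ ψ _ (restrict c.1 τ) = c.2 ∧
        ∃ h : x ∘ τ ∈ rationalBox c.1.2.1, F c.1 ⟨_, h⟩ = a := by
    intro a
    obtain ⟨r, τ, b, g, hb, h, hg⟩ := exists_representation hx a
    exact ⟨(⟨r, b, g⟩, ψ r (restrict ⟨r, b, g⟩ τ)), τ, hb, rfl, h, funext hg⟩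
  choose φ hφ using hcol
  refine ⟨_, φ, ?_, ?_⟩
  · rw [Cardinal.mk_prod, Cardinal.lift_id, Cardinal.lift_id, Cardinal.mk_out]
    exact Cardinal.mul_le_of_le hκ (mk_algebraicTuple_le hκ hK n) le_rfl
  rintro α _ ⟨a, ha, rfl, hpa⟩
  by_contra! hmono
  obtain ⟨C, c, hC, hc⟩ := HGColorable.of_chrNum_le
    (fun e he => exists_ne_of_mem_zeroEdges (hk α) he) (hchr α)
  have hk0 : 0 < k α := two_pos.trans_le (hk α)
  have hcol := fun j => hmono _ ⟨j, rfl⟩ _ ⟨⟨0, hk0⟩, rfl⟩ ▸ hφ (a j)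
  generalize φ (a ⟨0, hk0⟩) = col at hcol
  obtain ⟨s, d⟩ := col
  choose τ hb hτψ hτ hτa using hcol
  have hsep : ∀ j j', j ≠ j' → ∃ i ∈ D s.1 d, i ∈ essentialCoords (F s) ∧ τ j i ≠ τ j' i := by
    intro j j' hj
    have hne : restrict s (τ j) ≠ restrict s (τ j') := by
      intro h
      refine hj (ha ?_)
      rw [← hτa j, ← hτa j']
      refine eq_of_eqOn_essentialCoords fun i hi => congrArg x ?_
      simpa [restrict, hi] using congrFun h i
    obtain ⟨i, hi, hne⟩ := hψ _ d _ (hτψ j) _ (hτψ j') hne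
    have hess : i ∈ essentialCoords (F s) := by
      by_contra h
      exact hne (by simp [restrict, h])
    exact ⟨i, hi, hess, by simpa [restrict, hess] using hne⟩
  have hpτ : MvPolynomial.aeval
      (fun t : Fin (k α) × Fin n => (s.2.2 t.2).1.1 ⟨_, hτ t.1⟩) (q α) = 0 := by
    rw [haeval, ← hpa]
    exact congrArg (fun f => MvPolynomial.eval f (p α)) (funext fun t => congrFun (hτa t.1) t.2)
  obtain ⟨z, hz, hpz, d', hd'⟩ := exists_monochromatic_zero hκ hC hx.1 (hb ⟨0, hk0⟩)
    (fun l => (s.2.2 l).2) hτ (hD _ d) hsep hpτ c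
  obtain ⟨_, ⟨i, rfl⟩, _, ⟨j, rfl⟩, hij⟩ := hc _ ⟨z, hz, rfl, (haeval α _).symm.trans hpz⟩
  exact hij ((hd' i).trans (hd' j).symm)
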